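/- arXiv:1104.0450 — 2 statements merged into one kernel-verified Lean document; each statement's English description precedes it below -/
import Mathlib

section
/- Let C > 0, let Ω ⊂ ℝ² be a normalized convex domain, and let f ∈ 𝒮(Ω,C) satisfy PDE (1.2) with parameter β = 0. If the Euclidean gradient satisfies ‖grad f‖_E ≤ C₀ on Ω for some constant C₀, then for every C' with 0 < C' < C the estimate det(f_ij) ≤ b₀ holds on the section S_f(C') = {x ∈ Ω : f(x) ≤ C'}, where b₀ is a constant depending only on C, C'/C and C₀. -/
open Real Filter Topology Matrix

noncomputable section

/-- The `i`-th partial derivative of `f`. -/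
def pd {n : ℕ} (i : Fin n) (f : (Fin n → ℝ) → ℝ) : (Fin n → ℝ) → ℝ :=
  fun x => fderiv ℝ f x (Pi.single i 1)

/-- The Hessian matrix `(∂²f/∂x_i∂x_j)` of `f` at `x`. -/
def hess {n : ℕ} (f : (Fin n → ℝ) → ℝ) (x : Fin n → ℝ) : Matrix (Fin n) (Fin n) ℝ :=
  Matrix.of fun i j => pd i (pd j f) x

/-- The gradient vector of `f` at `x`. -/
def gradv {n : ℕ} (f : (Fin n → ℝ) → ℝ) (x : Fin n → ℝ) : Fin n → ℝ :=
  fun i => pd i f x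

/-- `ρ := (det (f_ij))^(-1/(n+2))`. -/
def rho {n : ℕ} (f : (Fin n → ℝ) → ℝ) (x : Fin n → ℝ) : ℝ :=
  (hess f x).det ^ (-(1 : ℝ) / ((n : ℝ) + 2))

/-- The squared norm `‖grad h‖² = ∑ f^{ij} h_i h_j` with respect to the Calabi metric of `f`. -/
def gradSq {n : ℕ} (f h : (Fin n → ℝ) → ℝ) (x : Fin n → ℝ) : ℝ :=
  ∑ i, ∑ j, (hess f x)⁻¹ i j * pd i h x * pd j h x

/-- The Laplacian `Δh = (1/√det)(∑ ∂_i(√det · f^{ij} ∂_j h))` with respect to the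
Calabi metric of `f`. -/
def calabiLap {n : ℕ} (f h : (Fin n → ℝ) → ℝ) (x : Fin n → ℝ) : ℝ :=
  (Real.sqrt (hess f x).det)⁻¹ *
    ∑ i, ∑ j, pd i (fun y => Real.sqrt (hess f y).det * (hess f y)⁻¹ i j * pd j h y) x

/-- `Φ := ‖grad ρ‖²/ρ²`. -/
def Phi {n : ℕ} (f : (Fin n → ℝ) → ℝ) (x : Fin n → ℝ) : ℝ :=
  gradSq f (rho f) x / (rho f x) ^ 2

/-- PDE (1.2): `Δρ = -β ‖grad ρ‖²/ρ` on `Ω`. -/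
def PDE2 {n : ℕ} (f : (Fin n → ℝ) → ℝ) (β : ℝ) (Ω : Set (Fin n → ℝ)) : Prop :=
  ∀ x ∈ Ω, calabiLap f (rho f) x = -β * gradSq f (rho f) x / rho f x

/-- The cofactor matrix of a square matrix. -/
def cof {n : ℕ} (H : Matrix (Fin n) (Fin n) ℝ) : Matrix (Fin n) (Fin n) ℝ :=
  (Matrix.adjugate H)ᵀ

/-- PDE (1.1): `∑ F^{ij} w_ij = 0` with `w = (det (f_ij))^a` on `Ω`, where `(F^{ij})`
is the cofactor matrix of the Hessian of `f`. -/
def PDE1 {n : ℕ} (f : (Fin n → ℝ) → ℝ) (a : ℝ) (Ω : Set (Fin n → ℝ)) : Prop :=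
  ∀ x ∈ Ω, ∑ i, ∑ j,
    cof (hess f x) i j * pd i (pd j fun y => (hess f y).det ^ a) x = 0

/-- `f` is a quadratic polynomial on `ℝ²`. -/
def IsQuadratic (f : (Fin 2 → ℝ) → ℝ) : Prop :=
  ∃ (Q : Matrix (Fin 2) (Fin 2) ℝ) (b : Fin 2 → ℝ) (c : ℝ),
    ∀ x, f x = (∑ i, ∑ j, Q i j * x i * x j) + (∑ i, b i * x i) + c

/-- Euclidean open ball of radius `r` centered at `0` in `ℝ²`. -/
def ebal (r : ℝ) : Set (Fin 2 → ℝ) := {x | (x 0) ^ 2 + (x 1) ^ 2 < r ^ 2}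

/-- Euclidean norm on `ℝ²`. -/
def enorm2 (x : Fin 2 → ℝ) : ℝ := Real.sqrt ((x 0) ^ 2 + (x 1) ^ 2)

/-- A normalized convex domain: `B_{2^{-3/2}}(0) ⊆ Ω ⊆ B_1(0)`. -/
def NormalizedDomain (Ω : Set (Fin 2 → ℝ)) : Prop :=
  IsOpen Ω ∧ Convex ℝ Ω ∧ ebal ((2 : ℝ) ^ (-(3 : ℝ) / 2)) ⊆ Ω ∧ Ω ⊆ ebal 1

/-- The class `𝒮(Ω,C)`: smooth strictly convex functions on `Ω` with `inf f = 0` and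
`f = C` on `∂Ω`. -/
def SClass (Ω : Set (Fin 2 → ℝ)) (C : ℝ) (f : (Fin 2 → ℝ) → ℝ) : Prop :=
  ContDiffOn ℝ (⊤ : ℕ∞) f Ω ∧ (∀ x ∈ Ω, (hess f x).PosDef) ∧
    sInf (f '' Ω) = 0 ∧ ContinuousOn f (closure Ω) ∧ ∀ x ∈ frontier Ω, f x = C

/-- `u` is the Legendre transform function of `f` relative to `0`:
`u(∇f(x)) = ⟨x, ∇f(x)⟩ - f(x)`. -/
def LegendreOf (Ω : Set (Fin 2 → ℝ)) (f u : (Fin 2 → ℝ) → ℝ) : Prop :=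
  ∀ x ∈ Ω, u (gradv f x) = (∑ i, x i * gradv f x i) - f x

end

open scoped ContDiff

abbrev V2 := Fin 2 → ℝ

lemma sm_pd {U : Set V2} (hU : IsOpen U) {g : V2 → ℝ} (hg : ContDiffOn ℝ ∞ g U) (i : Fin 2) :
    ContDiffOn ℝ ∞ (pd i g) U :=
  (hg.fderiv_of_isOpen hU (by simp)).clm_apply contDiffOn_const

lemma sm_diff {U : Set V2} (hU : IsOpen U) {g : V2 → ℝ} (hg : ContDiffOn ℝ ∞ g U) {x : V2}
    (hx : x ∈ U) : DifferentiableAt ℝ g x :=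
  (hg.contDiffAt (hU.mem_nhds hx)).differentiableAt (by simp)

lemma pd_congr {U : Set V2} (hU : IsOpen U) {g h : V2 → ℝ} (e : ∀ y ∈ U, g y = h y) {x : V2}
    (hx : x ∈ U) (i : Fin 2) : pd i g x = pd i h x := by
  have : g =ᶠ[𝓝 x] h := by
    filter_upwards [hU.mem_nhds hx] with y hy using e y hy
  simp only [pd, this.fderiv_eq]

lemma pd_mul {g h : V2 → ℝ} {x : V2} (hg : DifferentiableAt ℝ g x) (hh : DifferentiableAt ℝ h x)
    (i : Fin 2) : pd i (fun y => g y * h y) x = pd i g x * h x + g x * pd i h x := by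
  simp only [pd]
  rw [fderiv_fun_mul hg hh]
  simp; ring

lemma pd_add {g h : V2 → ℝ} {x : V2} (hg : DifferentiableAt ℝ g x) (hh : DifferentiableAt ℝ h x)
    (i : Fin 2) : pd i (fun y => g y + h y) x = pd i g x + pd i h x := by
  simp only [pd]
  rw [fderiv_fun_add hg hh]
  simp

lemma pd_sub {g h : V2 → ℝ} {x : V2} (hg : DifferentiableAt ℝ g x) (hh : DifferentiableAt ℝ h x)
    (i : Fin 2) : pd i (fun y => g y - h y) x = pd i g x - pd i h x := by
  simp only [pd]
  rw [fderiv_fun_sub hg hh]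
  simp

lemma pd_neg {g : V2 → ℝ} {x : V2} 
    (i : Fin 2) : pd i (fun y => - g y) x = - pd i g x := by
  simp only [pd]
  rw [fderiv_fun_neg]
  simp

lemma pd_const {k : ℝ} {x : V2} (i : Fin 2) : pd i (fun _ => k) x = 0 := by
  simp [pd]

lemma pd_cmul {g : V2 → ℝ} {x : V2} (hg : DifferentiableAt ℝ g x) (k : ℝ)
    (i : Fin 2) : pd i (fun y => k * g y) x = k * pd i g x := by
  rw [pd_mul (differentiableAt_const k) hg, pd_const]; ring

lemma pd_comp {φ : ℝ → ℝ} {φ' : ℝ} {g : V2 → ℝ} {x : V2} (hφ : HasDerivAt φ φ' (g x))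
    (hg : DifferentiableAt ℝ g x) (i : Fin 2) :
    pd i (fun y => φ (g y)) x = φ' * pd i g x := by
  have := (hφ.comp_hasFDerivAt x hg.hasFDerivAt).fderiv
  simp only [pd]
  change (fderiv ℝ (φ ∘ g) x) _ = _
  rw [this]; simp

lemma pd_symm {U : Set V2} (hU : IsOpen U) {g : V2 → ℝ} (hg : ContDiffOn ℝ ∞ g U) {x : V2}
    (hx : x ∈ U) (i j : Fin 2) : pd i (pd j g) x = pd j (pd i g) x := by
  have h := (hg.contDiffAt (hU.mem_nhds hx)).isSymmSndFDerivAt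
    (by simp only [minSmoothness_of_isRCLikeNormedField]; exact WithTop.coe_le_coe.2 le_top)
  have hd : DifferentiableAt ℝ (fderiv ℝ g) x :=
    ((hg.fderiv_of_isOpen hU (m := ∞) (by simp)).contDiffAt (hU.mem_nhds hx)).differentiableAt (by simp)
  have key : ∀ i j : Fin 2, pd i (pd j g) x
      = fderiv ℝ (fderiv ℝ g) x (Pi.single i 1) (Pi.single j 1) := by
    intro i j
    unfold pd
    rw [fderiv_clm_apply hd (differentiableAt_const _)]
    simp
  rw [key, key]; exact h.eq _ _

/-- derivative along a line -/
lemma line_deriv {g : V2 → ℝ} {x v : V2} {t : ℝ} (hg : DifferentiableAt ℝ g (x + t • v)) :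
    HasDerivAt (fun s : ℝ => g (x + s • v))
      (v 0 * pd 0 g (x + t • v) + v 1 * pd 1 g (x + t • v)) t := by
  have h1 : HasDerivAt (fun s : ℝ => x + s • v) v t := by
    simpa using ((hasDerivAt_id t).smul_const v).const_add x
  have h2 := hg.hasFDerivAt.comp_hasDerivAt t h1
  have hv : v = v 0 • (Pi.single 0 1 : V2) + v 1 • (Pi.single 1 1 : V2) := by
    ext k; fin_cases k <;> simp
  have h3 : fderiv ℝ g (x + t • v) v
      = v 0 * pd 0 g (x + t • v) + v 1 * pd 1 g (x + t • v) := by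
    conv_lhs => rw [hv]
    simp only [map_add, map_smul, smul_eq_mul]
    rw [← hv]; rfl
  rw [← h3]; exact h2

lemma second_deriv_le {g : ℝ → ℝ} (hmax : IsLocalMax g 0) (hc : ContinuousAt g 0) :
    deriv (deriv g) 0 ≤ 0 := by
  by_contra! hpos
  have hmin := isLocalMin_of_deriv_deriv_pos hpos hmax.deriv_eq_zero hc
  have he : g =ᶠ[𝓝 0] fun _ => g 0 := by
    filter_upwards [hmax, hmin] with y h1 h2 using le_antisymm h1 h2
  have := he.deriv.deriv_eq
  simp at this
  linarith

lemma max_first {g : V2 → ℝ} {x : V2} (hmax : IsLocalMax g x) (i : Fin 2) : pd i g x = 0 := by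
  simp [pd, hmax.fderiv_eq_zero]

lemma max_second {U : Set V2} (hU : IsOpen U) {g : V2 → ℝ} (hg : ContDiffOn ℝ ∞ g U) {x : V2}
    (hx : x ∈ U) (hmax : IsLocalMax g x) (v : V2) :
    v 0 * v 0 * pd 0 (pd 0 g) x + 2 * (v 0 * v 1) * pd 0 (pd 1 g) x
      + v 1 * v 1 * pd 1 (pd 1 g) x ≤ 0 := by
  have hcont : Continuous (fun s : ℝ => x + s • v) := by fun_prop
  have hx0 : x + (0:ℝ) • v = x := by simp
  have hev : ∀ᶠ t : ℝ in 𝓝 0, x + t • v ∈ U := by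
    apply hcont.continuousAt.eventually_mem
    rw [hx0]; exact hU.mem_nhds hx
  have hm : IsLocalMax (fun s : ℝ => g (x + s • v)) 0 := by
    have : Tendsto (fun s : ℝ => x + s • v) (𝓝 0) (𝓝 x) := by
      have := hcont.tendsto 0
      rwa [hx0] at this
    have h := this.eventually hmax
    unfold IsLocalMax IsMaxFilter
    simpa using h
  have hd0 : DifferentiableAt ℝ g (x + (0:ℝ) • v) := by rw [hx0]; exact sm_diff hU hg hx
  have h := second_deriv_le hm (line_deriv hd0).continuousAt
  have e : deriv (fun s : ℝ => g (x + s • v)) =ᶠ[𝓝 0]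
      fun t => v 0 * pd 0 g (x + t • v) + v 1 * pd 1 g (x + t • v) := by
    filter_upwards [hev] with t ht using (line_deriv (sm_diff hU hg ht)).deriv
  have hp : ∀ i, DifferentiableAt ℝ (pd i g) (x + (0:ℝ) • v) := by
    intro i; rw [hx0]; exact sm_diff hU (sm_pd hU hg i) hx
  have h2 := ((line_deriv (hp 0)).const_mul (v 0)).add ((line_deriv (hp 1)).const_mul (v 1))
  rw [e.deriv_eq] at h
  have h3 := h2.deriv
  simp only [hx0] at h3
  have h4 : deriv (fun t : ℝ => v 0 * pd 0 g (x + t • v) + v 1 * pd 1 g (x + t • v)) 0 = _ := h3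
  rw [h4, pd_symm hU hg hx 1 0] at h
  linarith

/-- the Hessian determinant, written out -/
noncomputable def Dd (f : V2 → ℝ) (y : V2) : ℝ :=
  pd 0 (pd 0 f) y * pd 1 (pd 1 f) y - pd 0 (pd 1 f) y * pd 0 (pd 1 f) y

lemma hess_eq {U : Set V2} (hU : IsOpen U) {f : V2 → ℝ} (hf : ContDiffOn ℝ ∞ f U) {x : V2}
    (hx : x ∈ U) : hess f x = !![pd 0 (pd 0 f) x, pd 0 (pd 1 f) x;
      pd 0 (pd 1 f) x, pd 1 (pd 1 f) x] := by
  ext i j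
  fin_cases i <;> fin_cases j <;> simp [hess]
  exact pd_symm hU hf hx 1 0

lemma det_eq {U : Set V2} (hU : IsOpen U) {f : V2 → ℝ} (hf : ContDiffOn ℝ ∞ f U) {x : V2}
    (hx : x ∈ U) : (hess f x).det = Dd f x := by
  rw [hess_eq hU hf hx, Matrix.det_fin_two_of, Dd]

lemma sm_Dd {U : Set V2} (hU : IsOpen U) {f : V2 → ℝ} (hf : ContDiffOn ℝ ∞ f U) :
    ContDiffOn ℝ ∞ (Dd f) U := by
  have h : ∀ i j, ContDiffOn ℝ ∞ (pd i (pd j f)) U := fun i j => sm_pd hU (sm_pd hU hf j) i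
  exact ((h 0 0).mul (h 1 1)).sub ((h 0 1).mul (h 0 1))

/-- log det -/
noncomputable def Ld (f : V2 → ℝ) (y : V2) : ℝ := Real.log (Dd f y)

lemma sm_Ld {U : Set V2} (hU : IsOpen U) {f : V2 → ℝ} (hf : ContDiffOn ℝ ∞ f U)
    (hD : ∀ y ∈ U, 0 < Dd f y) : ContDiffOn ℝ ∞ (Ld f) U :=
  (sm_Dd hU hf).log (fun y hy => (hD y hy).ne')

/-- cofactors -/
noncomputable def Fc (f : V2 → ℝ) (i j : Fin 2) (y : V2) : ℝ :=
  !![pd 1 (pd 1 f) y, - pd 0 (pd 1 f) y; - pd 0 (pd 1 f) y, pd 0 (pd 0 f) y] i j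

lemma pd_Ld {U : Set V2} (hU : IsOpen U) {f : V2 → ℝ} (hf : ContDiffOn ℝ ∞ f U)
    (hD : ∀ y ∈ U, 0 < Dd f y) {x : V2} (hx : x ∈ U) (i : Fin 2) :
    Dd f x * pd i (Ld f) x = pd i (pd 0 (pd 0 f)) x * pd 1 (pd 1 f) x
      + pd 0 (pd 0 f) x * pd i (pd 1 (pd 1 f)) x
      - 2 * (pd 0 (pd 1 f) x * pd i (pd 0 (pd 1 f)) x) := by
  have h : ∀ i j, DifferentiableAt ℝ (pd i (pd j f)) x :=
    fun i j => sm_diff hU (sm_pd hU (sm_pd hU hf j) i) hx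
  have hd := hD x hx
  have e1 : pd i (Ld f) x = (Dd f x)⁻¹ * pd i (Dd f) x :=
    pd_comp (Real.hasDerivAt_log hd.ne') (sm_diff hU (sm_Dd hU hf) hx) i
  have e2 : pd i (Dd f) x = _ := pd_sub ((h 0 0).mul (h 1 1)) ((h 0 1).mul (h 0 1)) i
  rw [e1, mul_inv_cancel_left₀ hd.ne', e2]
  erw [pd_mul (h 0 0) (h 1 1), pd_mul (h 0 1) (h 0 1)]
  ring

lemma pde_key {U : Set V2} (hU : IsOpen U) {f : V2 → ℝ} (hf : ContDiffOn ℝ ∞ f U)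
    (hD : ∀ y ∈ U, 0 < Dd f y) (hP : PDE2 f 0 U) {x : V2} (hx : x ∈ U) :
    pd 1 (pd 1 f) x * pd 0 (pd 0 (Ld f)) x - 2 * (pd 0 (pd 1 f) x * pd 0 (pd 1 (Ld f)) x)
      + pd 0 (pd 0 f) x * pd 1 (pd 1 (Ld f)) x
    = 3 / 4 * (pd 1 (pd 1 f) x * pd 0 (Ld f) x ^ 2
      - 2 * (pd 0 (pd 1 f) x * (pd 0 (Ld f) x * pd 1 (Ld f) x))
      + pd 0 (pd 0 f) x * pd 1 (Ld f) x ^ 2) := by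
  have hL := sm_Ld hU hf hD
  have hW : ContDiffOn ℝ ∞ (fun y => Real.exp (-(3/4) * Ld f y)) U :=
    (contDiffOn_const.mul hL).exp
  have h2 : ∀ i j, ContDiffOn ℝ ∞ (pd i (pd j f)) U := fun i j => sm_pd hU (sm_pd hU hf j) i
  have hF : ∀ i j, ContDiffOn ℝ ∞ (Fc f i j) U := by
    intro i j
    fin_cases i <;> fin_cases j
    · exact h2 1 1
    · exact (h2 0 1).neg
    · exact (h2 0 1).neg
    · exact h2 0 0
  have hrho : ∀ y ∈ U, rho f y = Real.exp (-(1/4) * Ld f y) := by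
    intro y hy
    rw [rho, det_eq hU hf hy, Real.rpow_def_of_pos (hD y hy), Ld]
    congr 1; push_cast; ring
  have hprho : ∀ j, ∀ y ∈ U, pd j (rho f) y
      = Real.exp (-(1/4) * Ld f y) * (-(1/4) * pd j (Ld f) y) := by
    intro j y hy
    rw [pd_congr hU hrho hy j]
    have hd := sm_diff hU hL hy
    rw [pd_comp (φ := Real.exp) (Real.hasDerivAt_exp _) (hd.const_mul (-(1/4))) j,
      pd_cmul hd]
  have hT : ∀ i j, ∀ y ∈ U, Real.sqrt (hess f y).det * (hess f y)⁻¹ i j * pd j (rho f) y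
      = Real.exp (-(3/4) * Ld f y) * (-(1/4) * (Fc f i j y * pd j (Ld f) y)) := by
    intro i j y hy
    have hd := hD y hy
    have hinv : (hess f y)⁻¹ i j = Real.exp (- Ld f y) * Fc f i j y := by
      rw [Matrix.inv_def, det_eq hU hf hy, hess_eq hU hf hy, Matrix.adjugate_fin_two_of,
        Real.exp_neg, Ld, Real.exp_log hd]
      simp [Fc]
    have hs : Real.sqrt (hess f y).det = Real.exp (1/2 * Ld f y) := by
      rw [det_eq hU hf hy, Real.sqrt_eq_rpow, Real.rpow_def_of_pos hd, Ld]
      congr 1; ring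
    have he : Real.exp (-(3/4) * Ld f y) = Real.exp (1/2 * Ld f y) * Real.exp (- Ld f y)
        * Real.exp (-(1/4) * Ld f y) := by
      rw [← Real.exp_add, ← Real.exp_add]; congr 1; ring
    rw [hinv, hs, hprho j y hy, he]; ring
  have hpT : ∀ i j, pd i (fun y => Real.sqrt (hess f y).det * (hess f y)⁻¹ i j * pd j (rho f) y) x
      = Real.exp (-(3/4) * Ld f x) * (-(1/4)) * (-(3/4) * pd i (Ld f) x * (Fc f i j x * pd j (Ld f) x)
        + (pd i (Fc f i j) x * pd j (Ld f) x + Fc f i j x * pd i (pd j (Ld f)) x)) := by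
    intro i j
    rw [pd_congr hU (hT i j) hx i]
    have hd := sm_diff hU hL hx
    have dF := sm_diff hU (hF i j) hx
    have dL := sm_diff hU (sm_pd hU hL j) hx
    rw [pd_mul (sm_diff hU hW hx) ((dF.fun_mul dL).const_mul _),
      pd_comp (φ := Real.exp) (Real.hasDerivAt_exp _) (hd.const_mul (-(3/4))) i,
      pd_cmul hd]
    rw [pd_cmul (dF.fun_mul dL), pd_mul dF dL]
    ring
  have hdet := hD x hx
  have h0 := hP x hx
  rw [calabiLap] at h0
  simp only [neg_zero, zero_mul, zero_div] at h0
  have hs : (Real.sqrt (hess f x).det)⁻¹ ≠ 0 := by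
    rw [det_eq hU hf hx]; positivity
  have h1 := (mul_eq_zero.1 h0).resolve_left hs
  simp only [Fin.sum_univ_two, hpT] at h1
  have hE := (Real.exp_pos (-(3/4) * Ld f x)).ne'
  have f00 : pd 0 (Fc f 0 0) x = pd 0 (pd 1 (pd 1 f)) x := rfl
  have f01 : pd 0 (Fc f 0 1) x = - pd 0 (pd 0 (pd 1 f)) x := pd_neg 0
  have f10 : pd 1 (Fc f 1 0) x = - pd 0 (pd 1 (pd 1 f)) x := by
    rw [pd_symm hU (sm_pd hU hf 1) hx 0 1]; exact pd_neg 1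
  have f11 : pd 1 (Fc f 1 1) x = pd 0 (pd 0 (pd 1 f)) x := by
    change pd 1 (pd 0 (pd 0 f)) x = _
    rw [pd_symm hU (sm_pd hU hf 0) hx 1 0]
    exact pd_congr hU (fun y hy => pd_symm hU hf hy 1 0) hx 0
  have F00 : Fc f 0 0 x = pd 1 (pd 1 f) x := rfl
  have F01 : Fc f 0 1 x = - pd 0 (pd 1 f) x := rfl
  have F10 : Fc f 1 0 x = - pd 0 (pd 1 f) x := rfl
  have F11 : Fc f 1 1 x = pd 0 (pd 0 f) x := rfl
  rw [f00, f01, f10, f11, F00, F01, F10, F11, pd_symm hU hL hx 1 0] at h1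
  apply mul_left_cancel₀ hE
  linear_combination -4 * h1

lemma alg {a b c D L1 L2 L11 L12 L22 p q s M m t1 t2 t3 : ℝ} {f111 f112 f122 f222 : ℝ}
    (ha : 0 < a) (hc : 0 < c) (hD : D = a * c - b * b) (hDp : 0 < D) (hM : 0 < M) (hmp : 0 < m) (hmM : m * M = 1) (hs : 0 < s)
    (hpq : p ^ 2 + q ^ 2 ≤ M)
    (hp : c * L11 - 2 * (b * L12) + a * L22
      = 3 / 4 * (c * L1 ^ 2 - 2 * (b * (L1 * L2)) + a * L2 ^ 2))
    (hL1 : D * L1 = f111 * c + a * f122 - 2 * (b * f112))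
    (hL2 : D * L2 = f112 * c + a * f222 - 2 * (b * f122))
    (h1 : L1 - 2 * s * p + 2 * m * (p * a + q * b) = 0)
    (h2 : L2 - 2 * s * q + 2 * m * (p * b + q * c) = 0)
    (h11 : t1 = L11 - 2 * s * a - 2 * s ^ 2 * p ^ 2
      + 2 * m * (a * a + b * b + p * f111 + q * f112))
    (hq : b * b * t1 - 2 * (b * a) * t2 + a * a * t3 ≤ 0)
    (ht3 : t3 = L22 - 2 * s * c - 2 * s ^ 2 * q ^ 2
      + 2 * m * (b * b + c * c + p * f122 + q * f222)) (h1n : t1 ≤ 0)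
    (h12 : t2 = L12 - 2 * s * b - 2 * s ^ 2 * (p * q)
      + 2 * m * (a * b + b * c + p * f112 + q * f122)) :
    D ≤ 9 * s ^ 2 * M ^ 2 := by
  have htr : c * t1 - 2 * b * t2 + a * t3 ≤ 0 := by
    have : a * (c * t1 - 2 * b * t2 + a * t3) ≤ 0 := by
      have : D * t1 ≤ 0 := mul_nonpos_of_nonneg_of_nonpos hDp.le h1n
      rw [hD] at this
      linarith [show a * (c * t1 - 2 * b * t2 + a * t3) = (a * c - b * b) * t1 + (b * b * t1 - 2 * (b * a) * t2 + a * a * t3) by ring]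
    by_contra! h
    have := mul_pos ha h
    linarith
  have e1 : L1 = 2 * s * p - 2 * m * (p * a + q * b) := by linarith
  have e2 : L2 = 2 * s * q - 2 * m * (p * b + q * c) := by linarith
  have key : c * t1 - 2 * b * t2 + a * t3 = s ^ 2 * (c * p ^ 2 - 2 * b * p * q + a * q ^ 2)
      + D * (- 4 * s - 2 * s * m * (p ^ 2 + q ^ 2)
        - m ^ 2 * (a * p ^ 2 + 2 * b * p * q + c * q ^ 2) + 2 * m * (a + c)) := by
    have : c * t1 - 2 * b * t2 + a * t3 = (c * L11 - 2 * (b * L12) + a * L22) - 4 * s * D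
        - 2 * s ^ 2 * (c * p ^ 2 - 2 * b * p * q + a * q ^ 2) + 2 * m * (D * (a + c))
        + 2 * m * (p * (D * L1) + q * (D * L2)) := by
      rw [h11, h12, ht3, hL1, hL2, hD]; ring
    rw [this, hp, e1, e2, hD]; ring
  have hFpos : 0 ≤ c * p ^ 2 - 2 * b * p * q + a * q ^ 2 := by
    have : 0 ≤ c * (c * p ^ 2 - 2 * b * p * q + a * q ^ 2) := by
      have : c * (c * p ^ 2 - 2 * b * p * q + a * q ^ 2) = (c * p - b * q) ^ 2 + D * q ^ 2 := by
        rw [hD]; ring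
      rw [this]; positivity
    exact nonneg_of_mul_nonneg_right this hc
  have hbr : - 4 * s - 2 * s * m * (p ^ 2 + q ^ 2)
        - m ^ 2 * (a * p ^ 2 + 2 * b * p * q + c * q ^ 2) + 2 * m * (a + c) ≤ 0 := by
    by_contra! h
    have h3 := mul_pos hDp h
    have h4 : 0 ≤ s ^ 2 * (c * p ^ 2 - 2 * b * p * q + a * q ^ 2) := by positivity
    linarith
  have hqq : a * p ^ 2 + 2 * b * p * q + c * q ^ 2 ≤ (a + c) * M := by
    have h5 : 0 ≤ a * q ^ 2 - 2 * b * p * q + c * p ^ 2 := by linarith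
    have : (a + c) * (p ^ 2 + q ^ 2) ≤ (a + c) * M := by gcongr
    linarith
  have hA : m ^ 2 * (a * p ^ 2 + 2 * b * p * q + c * q ^ 2) ≤ m * (a + c) := by
    calc _ ≤ m ^ 2 * ((a + c) * M) := by gcongr
      _ = (m * M) * (m * (a + c)) := by ring
      _ = _ := by rw [hmM]; ring
  have hB : 2 * s * m * (p ^ 2 + q ^ 2) ≤ 2 * s := by
    calc _ ≤ 2 * s * m * M := by gcongr
      _ = 2 * s * (m * M) := by ring
      _ = _ := by rw [hmM]; ring
  have hC : m * (a + c) ≤ 6 * s := by linarith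
  have hE : a + c ≤ 6 * s * M := by
    calc a + c = (m * M) * (a + c) := by rw [hmM]; ring
      _ = (m * (a + c)) * M := by ring
      _ ≤ _ := by gcongr
  have : (a + c) ^ 2 ≤ (6 * s * M) ^ 2 := by gcongr
  have h9 : (6 * s * M) ^ 2 = 4 * (9 * s ^ 2 * M ^ 2) := by ring
  have h10 : 4 * D = (a + c) ^ 2 - (a - c) ^ 2 - 4 * b ^ 2 := by rw [hD]; ring
  linarith [sq_nonneg (a - c), sq_nonneg b]

lemma pdZ1 {L N p q : V2 → ℝ} {x : V2} (m : ℝ) (hL : DifferentiableAt ℝ L x)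
    (hN : DifferentiableAt ℝ N x) (hp : DifferentiableAt ℝ p x) (hq : DifferentiableAt ℝ q x)
    (i : Fin 2) :
    pd i (fun y => L y + 2 * N y + m * (p y * p y + q y * q y)) x
      = pd i L x + 2 * pd i N x + 2 * m * (p x * pd i p x + q x * pd i q x) := by
  rw [pd_add (by fun_prop) (by fun_prop), pd_add (by fun_prop) (by fun_prop),
    pd_cmul (by fun_prop), pd_cmul (by fun_prop), pd_add (by fun_prop) (by fun_prop),
    pd_mul hp hp, pd_mul hq hq]
  ring

lemma pdZ2 {L S g p q r t : V2 → ℝ} {x : V2} (m : ℝ) (hL : DifferentiableAt ℝ L x)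
    (hS : DifferentiableAt ℝ S x) (hg : DifferentiableAt ℝ g x)
    (hp : DifferentiableAt ℝ p x) (hq : DifferentiableAt ℝ q x)
    (hr : DifferentiableAt ℝ r x) (ht : DifferentiableAt ℝ t x) (i : Fin 2) :
    pd i (fun y => L y - 2 * (S y * g y) + 2 * m * (p y * r y + q y * t y)) x
      = pd i L x - 2 * (pd i S x * g x + S x * pd i g x)
        + 2 * m * (pd i p x * r x + p x * pd i r x + (pd i q x * t x + q x * pd i t x)) := by
  rw [pd_add (by fun_prop) (by fun_prop), pd_sub (by fun_prop) (by fun_prop),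
    pd_cmul (by fun_prop), pd_cmul (by fun_prop), pd_add (by fun_prop) (by fun_prop),
    pd_mul hp hr, pd_mul hq ht, pd_mul hS hg]

/-- The auxiliary function. -/
noncomputable def Zf (f : V2 → ℝ) (K m : ℝ) (y : V2) : ℝ :=
  Ld f y + 2 * Real.log (K - f y) + m * (pd 0 f y * pd 0 f y + pd 1 f y * pd 1 f y)

lemma max_est {U : Set V2} (hU : IsOpen U) {f : V2 → ℝ} (hf : ContDiffOn ℝ ∞ f U)
    (hD : ∀ y ∈ U, 0 < Dd f y) (ha : ∀ y ∈ U, 0 < pd 0 (pd 0 f) y)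
    (hc : ∀ y ∈ U, 0 < pd 1 (pd 1 f) y)
    (hP : PDE2 f 0 U) {K M m : ℝ} (hM : 0 < M) (hm : 0 < m) (hmM : m * M = 1)
    (hK : ∀ y ∈ U, f y < K) {x : V2} (hx : x ∈ U)
    (hg : pd 0 f x ^ 2 + pd 1 f x ^ 2 ≤ M) (hmax : IsLocalMax (Zf f K m) x) :
    Dd f x ≤ 9 * ((K - f x)⁻¹) ^ 2 * M ^ 2 := by
  have hL := sm_Ld hU hf hD
  have hKf : ContDiffOn ℝ ∞ (fun y => K - f y) U := contDiffOn_const.sub hf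
  have hK0 : ∀ y ∈ U, K - f y ≠ 0 := fun y hy => (sub_pos.2 (hK y hy)).ne'
  have hN : ContDiffOn ℝ ∞ (fun y => Real.log (K - f y)) U := hKf.log hK0
  have hS : ContDiffOn ℝ ∞ (fun y => (K - f y)⁻¹) U := hKf.inv hK0
  have hp := fun i => sm_pd hU hf i
  have hpp := fun i j => sm_pd hU (hp j) i
  have hZ : ContDiffOn ℝ ∞ (Zf f K m) U :=
    (hL.add (contDiffOn_const.mul hN)).add
      (contDiffOn_const.mul (((hp 0).mul (hp 0)).add ((hp 1).mul (hp 1))))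
  have dKf : ∀ i, ∀ y ∈ U, pd i (fun y => K - f y) y = - pd i f y := by
    intro i y hy
    rw [pd_sub (differentiableAt_const K) (sm_diff hU hf hy), pd_const]; ring
  have Z1 : ∀ i, ∀ y ∈ U, pd i (Zf f K m) y = pd i (Ld f) y - 2 * ((K - f y)⁻¹ * pd i f y)
      + 2 * m * (pd 0 f y * pd i (pd 0 f) y + pd 1 f y * pd i (pd 1 f) y) := by
    intro i y hy
    have h1 := pdZ1 m (sm_diff hU hL hy) (sm_diff hU hN hy) (sm_diff hU (hp 0) hy)
      (sm_diff hU (hp 1) hy) i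
    have h2 : pd i (Zf f K m) y = _ := h1
    rw [h2, pd_comp (φ := Real.log) (Real.hasDerivAt_log (hK0 y hy)) (sm_diff hU hKf hy),
      dKf i y hy]
    ring
  have Z2 : ∀ j i, pd j (pd i (Zf f K m)) x = pd j (pd i (Ld f)) x
      - 2 * (((K - f x)⁻¹) ^ 2 * pd j f x * pd i f x + (K - f x)⁻¹ * pd j (pd i f) x)
      + 2 * m * (pd j (pd 0 f) x * pd i (pd 0 f) x + pd 0 f x * pd j (pd i (pd 0 f)) x
        + (pd j (pd 1 f) x * pd i (pd 1 f) x + pd 1 f x * pd j (pd i (pd 1 f)) x)) := by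
    intro j i
    rw [pd_congr hU (Z1 i) hx j,
      pdZ2 m (sm_diff hU (sm_pd hU hL i) hx) (sm_diff hU hS hx) (sm_diff hU (hp i) hx)
        (sm_diff hU (hp 0) hx) (sm_diff hU (hp 1) hx) (sm_diff hU (hpp i 0) hx)
        (sm_diff hU (hpp i 1) hx) j,
      pd_comp (φ := fun t => t⁻¹) (hasDerivAt_inv (hK0 x hx)) (sm_diff hU hKf hx), dKf j x hx]
    simp only [inv_pow]
    ring
  have key := pde_key hU hf hD hP hx
  have m0 := max_first hmax 0
  have m1 := max_first hmax 1
  rw [Z1 _ x hx] at m0 m1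
  have q1 := max_second hU hZ hx hmax ![1, 0]
  have q2 := max_second hU hZ hx hmax ![- pd 0 (pd 1 f) x, pd 0 (pd 0 f) x]
  simp at q1 q2
  have L0 := pd_Ld hU hf hD hx 0
  have L1 := pd_Ld hU hf hD hx 1
  have s10 : pd 1 (pd 0 f) x = pd 0 (pd 1 f) x := pd_symm hU hf hx 1 0
  have s010 : pd 0 (pd 1 (pd 0 f)) x = pd 0 (pd 0 (pd 1 f)) x :=
    pd_congr hU (fun y hy => pd_symm hU hf hy 1 0) hx 0
  have s100 : pd 1 (pd 0 (pd 0 f)) x = pd 0 (pd 0 (pd 1 f)) x := by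
    rw [pd_symm hU (hp 0) hx 1 0, s010]
  have s101 : pd 1 (pd 0 (pd 1 f)) x = pd 0 (pd 1 (pd 1 f)) x := pd_symm hU (hp 1) hx 1 0
  have s110 : pd 1 (pd 1 (pd 0 f)) x = pd 0 (pd 1 (pd 1 f)) x := by
    rw [← s101]; exact pd_congr hU (fun y hy => pd_symm hU hf hy 1 0) hx 1
  have z00 := Z2 0 0
  have z01 := Z2 0 1
  have z11 := Z2 1 1
  rw [s10] at m1 z01 z11
  rw [s100, s101] at L1
  rw [s010] at z01
  rw [s110] at z11
  refine alg (ha x hx) (hc x hx) (D := Dd f x) rfl (hD x hx) hM hm hmM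
    (inv_pos.2 (sub_pos.2 (hK x hx))) hg key
    (t1 := pd 0 (pd 0 (Zf f K m)) x) (t2 := pd 0 (pd 1 (Zf f K m)) x)
    (t3 := pd 1 (pd 1 (Zf f K m)) x) L0 L1 ?_ ?_ ?_ ?_ ?_ q1 ?_
  · linear_combination m0
  · linear_combination m1
  · rw [z00]; ring
  · linear_combination q2
  · rw [z11]; ring
  · rw [z01]; ring

theorem statement8 (C C' C₀ : ℝ) (hC : 0 < C) (hC' : 0 < C') (hC'C : C' < C)
    (hC₀ : 0 < C₀) :
    ∃ b₀ : ℝ, 0 < b₀ ∧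
      ∀ (Ω : Set (Fin 2 → ℝ)) (f : (Fin 2 → ℝ) → ℝ),
        NormalizedDomain Ω → SClass Ω C f → PDE2 f 0 Ω →
        (∀ x ∈ Ω, enorm2 (gradv f x) ≤ C₀) →
        ∀ x ∈ Ω, f x ≤ C' → (hess f x).det ≤ b₀ := by
  have hCC : 0 < (C - C') / 2 := by linarith
  refine ⟨9 * (C₀ ^ 2) ^ 2 * Real.exp 1 / ((C - C') / 2) ^ 2, by positivity, ?_⟩
  intro Ω f hΩ hS hP hG x hx hxC
  obtain ⟨hU, -, -, hΩ1⟩ := hΩ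
  obtain ⟨hf, hpd, -, hcont, hbd⟩ := hS
  have hf : ContDiffOn ℝ ∞ f Ω := hf
  have hD : ∀ y ∈ Ω, 0 < Dd f y := fun y hy => by
    rw [← det_eq hU hf hy]; exact (hpd y hy).det_pos
  have ha : ∀ y ∈ Ω, 0 < pd 0 (pd 0 f) y := fun y hy => (hpd y hy).diag_pos (i := 0)
  have hc : ∀ y ∈ Ω, 0 < pd 1 (pd 1 f) y := fun y hy => (hpd y hy).diag_pos (i := 1)
  have hM : 0 < C₀ ^ 2 := by positivity
  obtain ⟨M, hMe⟩ : ∃ M, M = C₀ ^ 2 := ⟨_, rfl⟩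
  obtain ⟨m, hme⟩ : ∃ m, m = 1 / M := ⟨_, rfl⟩
  rw [← hMe] at hM ⊢
  have hm : 0 < m := by rw [hme]; positivity
  have hmM : m * M = 1 := by rw [hme]; field_simp
  have hg : ∀ y ∈ Ω, pd 0 f y ^ 2 + pd 1 f y ^ 2 ≤ M := by
    intro y hy
    have h := hG y hy
    rw [enorm2, Real.sqrt_le_left hC₀.le] at h
    rw [hMe]; exact h
  obtain ⟨K, hKe⟩ : ∃ K, K = (C + C') / 2 := ⟨_, rfl⟩
  have hbdd : Bornology.IsBounded Ω := by
    refine (Metric.isBounded_closedBall (x := (0 : V2)) (r := 1)).subset fun y hy => ?_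
    have h : y 0 ^ 2 + y 1 ^ 2 < 1 ^ 2 := hΩ1 hy
    rw [mem_closedBall_zero_iff, pi_norm_le_iff_of_nonneg zero_le_one]
    intro i
    rw [Real.norm_eq_abs, abs_le_one_iff_mul_self_le_one]
    fin_cases i <;> simp <;> nlinarith [sq_nonneg (y 0), sq_nonneg (y 1)]
  have hcl : IsCompact (closure Ω) := hbdd.isCompact_closure
  have hT : IsCompact (closure Ω ∩ f ⁻¹' Set.Iic K) :=
    hcl.of_isClosed_subset (hcont.preimage_isClosed_of_isClosed isClosed_closure isClosed_Iic)
      Set.inter_subset_left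
  have hTΩ : closure Ω ∩ f ⁻¹' Set.Iic K ⊆ Ω := by
    rintro y ⟨hy, hyK⟩
    by_contra hn
    have : y ∈ frontier Ω := by rw [hU.frontier_eq]; exact ⟨hy, hn⟩
    have h1 := hbd y this
    have h2 : f y ≤ K := hyK
    linarith
  have hxT : x ∈ closure Ω ∩ f ⁻¹' Set.Iic K :=
    ⟨subset_closure hx, by show f x ≤ K; linarith⟩
  let P : V2 → ℝ := fun y => Dd f y * (K - f y) ^ 2
    * Real.exp (m * (pd 0 f y * pd 0 f y + pd 1 f y * pd 1 f y))
  have hPc : ContinuousOn P (closure Ω ∩ f ⁻¹' Set.Iic K) := by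
    have h0 := (sm_Dd hU hf).continuousOn
    have h1 := hf.continuousOn
    have h2 := fun i => (sm_pd hU hf i).continuousOn
    have : ContinuousOn P Ω :=
      (h0.mul ((continuousOn_const.sub h1).pow 2)).mul
        (continuousOn_const.mul (((h2 0).mul (h2 0)).add ((h2 1).mul (h2 1)))).rexp
    exact this.mono hTΩ
  obtain ⟨z, hzT, hz⟩ := hT.exists_isMaxOn ⟨x, hxT⟩ hPc
  have hzΩ := hTΩ hzT
  have hzK : f z ≤ K := hzT.2
  have hPx : 0 < P x := by
    have := hD x hx
    have : 0 < K - f x := by linarith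
    positivity
  have hPz : P x ≤ P z := hz hxT
  have hzlt : f z < K := by
    rcases hzK.lt_or_eq with h | h
    · exact h
    · have : P z = 0 := by simp [P, h]
      linarith
  have hV : IsOpen (Ω ∩ f ⁻¹' Set.Iio K) := hf.continuousOn.isOpen_inter_preimage hU isOpen_Iio
  have hzV : z ∈ Ω ∩ f ⁻¹' Set.Iio K := ⟨hzΩ, hzlt⟩
  have hZP : ∀ y ∈ Ω ∩ f ⁻¹' Set.Iio K, 0 < P y ∧ Zf f K m y = Real.log (P y) := by
    rintro y ⟨hy, hyK⟩
    have h1 := hD y hy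
    have h2 : 0 < K - f y := sub_pos.2 hyK
    refine ⟨by positivity, ?_⟩
    simp only [P]
    rw [Real.log_mul (by positivity) (by positivity), Real.log_mul (by positivity) (by positivity),
      Real.log_exp, Real.log_pow, Zf, Ld]
    push_cast; ring
  have hmax : IsLocalMax (Zf f K m) z := by
    filter_upwards [hV.mem_nhds hzV] with y hy
    rw [(hZP y hy).2, (hZP z hzV).2]
    exact Real.log_le_log (hZP y hy).1 (hz ⟨subset_closure hy.1, (show f y ≤ K from le_of_lt hy.2)⟩)
  have est := max_est hV (hf.mono Set.inter_subset_left) (fun y hy => hD y hy.1)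
    (fun y hy => ha y hy.1) (fun y hy => hc y hy.1) (fun y hy => hP y hy.1) hM hm hmM
    (fun y hy => hy.2) hzV (hg z hzΩ) hmax
  have hzpos : 0 < K - f z := sub_pos.2 hzlt
  have e1 : Dd f z * (K - f z) ^ 2 ≤ 9 * M ^ 2 := by
    calc _ ≤ 9 * ((K - f z)⁻¹) ^ 2 * M ^ 2 * (K - f z) ^ 2 := by gcongr
      _ = _ := by field_simp
  have e2 : P z ≤ 9 * M ^ 2 * Real.exp 1 := by
    have : m * (pd 0 f z * pd 0 f z + pd 1 f z * pd 1 f z) ≤ 1 := by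
      rw [← hmM]; gcongr; linarith [hg z hzΩ, sq (pd 0 f z), sq (pd 1 f z)]
    simp only [P]
    gcongr
  have e3 : Dd f x * ((C - C') / 2) ^ 2 ≤ P x := by
    have h1 := hD x hx
    have h2 : (C - C') / 2 ≤ K - f x := by linarith
    have h3 : 1 ≤ Real.exp (m * (pd 0 f x * pd 0 f x + pd 1 f x * pd 1 f x)) :=
      Real.one_le_exp (mul_nonneg hm.le (add_nonneg (mul_self_nonneg _) (mul_self_nonneg _)))
    calc _ ≤ Dd f x * (K - f x) ^ 2 := by gcongr
      _ ≤ _ := le_mul_of_one_le_right (by positivity) h3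
  rw [det_eq hU hf hx, le_div_iff₀ (by positivity)]
  linarith
end

section
/- Let f be a smooth, strictly convex function on a domain Ω ⊆ ℝ² satisfying PDE (1.2) with parameter β = 0, i.e. Δρ = 0. Then at every point of Ω where Φ > 0 the differential inequality ΔΦ ≥ ‖grad Φ‖²/Φ + Φ² holds. -/
open Real Filter Topology Matrix

theorem alg_core (a b c D T0 T1 T2 T3 Q0 Q1 Q2 Q3 Q4 p q r s t u0 u1 u2 u3 F F0 F1 F00 F01 F11 D0 D1 D00 D01 D11 : ℝ)
  (ha : 0 < a) (hD : 0 < D) (hDef : D = a*c-b*b)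
  (hD0 : D0 = T0*c + a*T2 - (T1*b+b*T1)) (hD1 : D1 = T1*c + a*T3 - (T2*b+b*T2))
  (R0 : D0 = -4*(p*D)) (R1 : D1 = -4*(q*D))
  (hD00 : D00 = c*Q0-2*b*Q1+a*Q2+2*T0*T2-2*T1^2)
  (hD01 : D01 = c*Q1-2*b*Q2+a*Q3+T0*T3-T1*T2)
  (hD11 : D11 = c*Q2-2*b*Q3+a*Q4+2*T1*T3-2*T2^2)
  (R00 : D00 = -4*(r*D+p*D0)) (R01 : D01 = -4*(s*D+p*D1)) (R11 : D11 = -4*(t*D+q*D1))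
  (P : c*(r+3*p*p)-2*b*(s+3*p*q)+a*(t+3*q*q)=0)
  (P0 : T2*(r+3*p*p)-2*T1*(s+3*p*q)+T0*(t+3*q*q)+c*(u0+6*p*r)-2*b*(u1+3*(p*s+q*r))+a*(u2+6*q*s)=0)
  (P1 : T3*(r+3*p*p)-2*T2*(s+3*p*q)+T1*(t+3*q*q)+c*(u1+6*p*s)-2*b*(u2+3*(p*t+q*s))+a*(u3+6*q*t)=0)
  (hN : F*D = c*p*p-2*b*p*q+a*q*q)
  (hN0 : F0*D+F*D0 = T2*p*p-2*T1*p*q+T0*q*q+2*c*p*r-2*b*(p*s+q*r)+2*a*q*s)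
  (hN1 : F1*D+F*D1 = T3*p*p-2*T2*p*q+T1*q*q+2*c*p*s-2*b*(p*t+q*s)+2*a*q*t)
  (hN00 : F00*D+F0*D0+F0*D0+F*D00 = Q2*p*p-2*Q1*p*q+Q0*q*q+4*T2*p*r-4*T1*(p*s+q*r)+4*T0*q*s
     + 2*c*(r*r+p*u0)-2*b*(r*s+p*u1+s*r+q*u0)+2*a*(s*s+q*u1))
  (hN01 : F01*D+F0*D1+F1*D0+F*D01 = Q3*p*p-2*Q2*p*q+Q1*q*q+2*T2*p*s-2*T1*(p*t+q*s)+2*T0*q*t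
     + 2*T3*p*r-2*T2*(p*s+q*r)+2*T1*q*s
     + 2*c*(s*r+p*u1)-2*b*(s*s+p*u2+t*r+q*u1)+2*a*(t*s+q*u2))
  (hN11 : F11*D+F1*D1+F1*D1+F*D11 = Q4*p*p-2*Q3*p*q+Q2*q*q+4*T3*p*s-4*T2*(p*t+q*s)+4*T1*q*t
     + 2*c*(s*s+p*u2)-2*b*(s*t+p*u3+t*s+q*u2)+2*a*(t*t+q*u3)) :
  D*a^2*(F*(c*F00-2*b*F01+a*F11+2*(c*p*F0-b*(p*F1+q*F0)+a*q*F1)) - (c*F0*F0-2*b*F0*F1+a*F1*F1) - F^3*D)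
   = D*F^2*(c*(T0+3*a*p)^2-2*b*(T0+3*a*p)*(T1+a*q+2*b*p)+a*(T1+a*q+2*b*p)^2) := by
  have e1 : D*(c*F00-2*b*F01+a*F11) =
     8*D*(c*p*F0-b*(p*F1+q*F0)+a*q*F1) - F*(c*D00-2*b*D01+a*D11)
     + q*q*(-4*(r*D+p*D0)-2*T0*T2+2*T1^2) - 2*p*q*(-4*(s*D+p*D1)-T0*T3+T1*T2)
     + p*p*(-4*(t*D+q*D1)-2*T1*T3+2*T2^2)
     + c*(4*T2*p*r-4*T1*(p*s+q*r)+4*T0*q*s+2*c*r*r-4*b*r*s+2*a*s*s)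
     - 2*b*(2*T2*p*s-2*T1*(p*t+q*s)+2*T0*q*t + 2*T3*p*r-2*T2*(p*s+q*r)+2*T1*q*s+2*c*s*r-2*b*(s*s+t*r)+2*a*t*s)
     + a*(4*T3*p*s-4*T2*(p*t+q*s)+4*T1*q*t+2*c*s*s-4*b*s*t+2*a*t*t)
     - 2*(c*p-b*q)*(T2*(r+3*p*p)-2*T1*(s+3*p*q)+T0*(t+3*q*q)+c*(6*p*r)-2*b*(3*(p*s+q*r))+a*(6*q*s))
     - 2*(a*q-b*p)*(T3*(r+3*p*p)-2*T2*(s+3*p*q)+T1*(t+3*q*q)+c*(6*p*s)-2*b*(3*(p*t+q*s))+a*(6*q*t)) := by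
    rw [R0] at hN0 hN00 hN01
    rw [R1] at hN1 hN01 hN11
    rw [R0] at R00
    rw [R1] at R01 R11
    rw [R0, R1]
    linear_combination c*hN00-2*b*hN01+a*hN11 + q*q*(R00-hD00)-2*p*q*(R01-hD01)+p*p*(R11-hD11) + 2*(c*p-b*q)*P0+2*(a*q-b*p)*P1
  clear hN00 hN01 hN11 P0 P1 hD00 hD01 hD11
  generalize hL : c*F00-2*b*F01+a*F11 = L at *
  have hc : c = (D+b*b)/a := by field_simp; linarith
  have hT2 : T2 = (-4*(p*D)+2*b*T1-c*T0)/a := by field_simp; linarith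
  have hT3 : T3 = (-4*(q*D)+2*b*T2-c*T1)/a := by field_simp; linarith
  have ht : t = -3*q*q - (c*(r+3*p*p)-2*b*(s+3*p*q))/a := by field_simp; linarith
  have hF : F = (c*p*p-2*b*p*q+a*q*q)/D := by field_simp; linarith
  have hF0 : F0 = (T2*p*p-2*T1*p*q+T0*q*q+2*c*p*r-2*b*(p*s+q*r)+2*a*q*s)/D+4*F*p := by
    rw [← hN0, R0]; field_simp; ring
  have hF1 : F1 = (T3*p*p-2*T2*p*q+T1*q*q+2*c*p*s-2*b*(p*t+q*s)+2*a*q*t)/D+4*F*q := by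
    rw [← hN1, R1]; field_simp; ring
  have hL' := eq_div_of_mul_eq hD.ne' ((mul_comm L D).trans e1)
  clear e1 hN hN0 hN1 P hL hDef hD0 hD1
  rw [hL', R00, R01, R11, R0, R1]
  clear hL' R00 R01 R11 R0 R1
  rw [hF0, hF1, hF]
  clear hF0 hF1 hF
  subst ht
  subst hT3
  subst hT2
  subst hc
  field_simp
  ring

theorem pd_smooth {Ω : Set (Fin 2 → ℝ)} (hΩ : IsOpen Ω) {g : (Fin 2 → ℝ) → ℝ}
    (hg : ContDiffOn ℝ (⊤ : ℕ∞) g Ω) (i : Fin 2) : ContDiffOn ℝ (⊤ : ℕ∞) (pd i g) Ω := by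
  have h1 : ContDiffOn ℝ (⊤ : ℕ∞) (fderiv ℝ g) Ω := hg.fderiv_of_isOpen hΩ (by simp)
  exact h1.clm_apply contDiffOn_const

theorem pd_congr_s16 {Ω : Set (Fin 2 → ℝ)} (hΩ : IsOpen Ω) {g k : (Fin 2 → ℝ) → ℝ}
    (h : ∀ y ∈ Ω, g y = k y) (i : Fin 2) : ∀ y ∈ Ω, pd i g y = pd i k y := by
  intro y hy
  have : g =ᶠ[𝓝 y] k := by
    filter_upwards [hΩ.mem_nhds hy] with z hz using h z hz
  unfold pd
  rw [this.fderiv_eq]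

theorem pd_comm {Ω : Set (Fin 2 → ℝ)} (hΩ : IsOpen Ω) {g : (Fin 2 → ℝ) → ℝ}
    (hg : ContDiffOn ℝ (⊤ : ℕ∞) g Ω) (i j : Fin 2) :
    ∀ y ∈ Ω, pd i (pd j g) y = pd j (pd i g) y := by
  intro y hy
  have hat : ContDiffAt ℝ (⊤ : ℕ∞) g y := hg.contDiffAt (hΩ.mem_nhds hy)
  have hsym : IsSymmSndFDerivAt ℝ g y := by
    apply hat.isSymmSndFDerivAt
    simp
    exact WithTop.coe_le_coe.2 le_top
  have hd : DifferentiableAt ℝ (fderiv ℝ g) y :=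
    (hat.fderiv_right (m := (⊤ : ℕ∞)) (by simp)).differentiableAt (by simp)
  have key : ∀ i j : Fin 2, pd i (pd j g) y
      = fderiv ℝ (fderiv ℝ g) y (Pi.single i 1) (Pi.single j 1) := by
    intro i j
    show fderiv ℝ (fun z => fderiv ℝ g z (Pi.single j 1)) y (Pi.single i 1) = _
    rw [fderiv_clm_apply hd (differentiableAt_const _)]
    simp
  rw [key, key]
  exact hsym _ _

/-- On `Ω`, `g` is differentiable with `i`-th partial derivative `g'`. -/
def HP (Ω : Set (Fin 2 → ℝ)) (i : Fin 2) (g g' : (Fin 2 → ℝ) → ℝ) : Prop :=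
  ∀ y ∈ Ω, DifferentiableAt ℝ g y ∧ pd i g y = g' y

namespace HP
variable {Ω : Set (Fin 2 → ℝ)} {i : Fin 2} {g k g' k' : (Fin 2 → ℝ) → ℝ}

theorem of_smooth (hΩ : IsOpen Ω) (hg : ContDiffOn ℝ (⊤ : ℕ∞) g Ω)
    (h : ∀ y ∈ Ω, pd i g y = g' y) : HP Ω i g g' := fun y hy =>
  ⟨(hg.contDiffAt (hΩ.mem_nhds hy)).differentiableAt (by simp), h y hy⟩

theorem add (h1 : HP Ω i g g') (h2 : HP Ω i k k') :
    HP Ω i (fun y => g y + k y) (fun y => g' y + k' y) := by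
  intro y hy
  refine ⟨(h1 y hy).1.add (h2 y hy).1, ?_⟩
  have := fderiv_fun_add (h1 y hy).1 (h2 y hy).1
  beta_reduce
  rw [← (h1 y hy).2, ← (h2 y hy).2]
  unfold pd
  rw [this]; rfl

theorem sub (h1 : HP Ω i g g') (h2 : HP Ω i k k') :
    HP Ω i (fun y => g y - k y) (fun y => g' y - k' y) := by
  intro y hy
  refine ⟨(h1 y hy).1.sub (h2 y hy).1, ?_⟩
  have := fderiv_fun_sub (h1 y hy).1 (h2 y hy).1
  beta_reduce
  rw [← (h1 y hy).2, ← (h2 y hy).2]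
  unfold pd
  rw [this]; rfl

theorem mul (h1 : HP Ω i g g') (h2 : HP Ω i k k') :
    HP Ω i (fun y => g y * k y) (fun y => g' y * k y + g y * k' y) := by
  intro y hy
  refine ⟨(h1 y hy).1.mul (h2 y hy).1, ?_⟩
  have := fderiv_fun_mul (h1 y hy).1 (h2 y hy).1
  beta_reduce
  rw [← (h1 y hy).2, ← (h2 y hy).2]
  unfold pd
  rw [this]; simp; ring

theorem cmul (r : ℝ) (h1 : HP Ω i g g') :
    HP Ω i (fun y => r * g y) (fun y => r * g' y) := by
  intro y hy
  refine ⟨(h1 y hy).1.const_mul r, ?_⟩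
  have := fderiv_const_mul (h1 y hy).1 r
  beta_reduce
  rw [← (h1 y hy).2]
  unfold pd
  rw [this]; simp

theorem zero : HP Ω i (fun _ => 0) (fun _ => 0) := by
  intro y hy
  refine ⟨differentiableAt_const _, ?_⟩
  unfold pd
  simp

theorem exp (h1 : HP Ω i g g') :
    HP Ω i (fun y => Real.exp (g y)) (fun y => Real.exp (g y) * g' y) := by
  intro y hy
  refine ⟨(h1 y hy).1.exp, ?_⟩
  have := fderiv_exp (h1 y hy).1
  beta_reduce
  rw [← (h1 y hy).2]
  unfold pd
  rw [this]; simp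

theorem log (h1 : HP Ω i g g') (h0 : ∀ y ∈ Ω, g y ≠ 0) :
    HP Ω i (fun y => Real.log (g y)) (fun y => (g y)⁻¹ * g' y) := by
  intro y hy
  refine ⟨(h1 y hy).1.log (h0 y hy), ?_⟩
  have := fderiv.log (h1 y hy).1 (h0 y hy)
  beta_reduce
  rw [← (h1 y hy).2]
  unfold pd
  rw [this]; simp

theorem rel (hΩ : IsOpen Ω) (h1 : HP Ω i g g') (h2 : HP Ω i k k') (h : ∀ y ∈ Ω, g y = k y) :
    ∀ y ∈ Ω, g' y = k' y := by
  intro y hy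
  rw [← (h1 y hy).2, ← (h2 y hy).2]
  exact pd_congr_s16 hΩ h i y hy

end HP

/-- The determinant data: everything needed about `f` on `Ω`. -/
theorem hess_facts {Ω : Set (Fin 2 → ℝ)} (hΩ : IsOpen Ω)
    {f : (Fin 2 → ℝ) → ℝ} (hsmooth : ContDiffOn ℝ (⊤ : ℕ∞) f Ω)
    (hconv : ∀ x ∈ Ω, (hess f x).PosDef) : ∃ a b c : (Fin 2 → ℝ) → ℝ,
    ContDiffOn ℝ (⊤ : ℕ∞) a Ω ∧ ContDiffOn ℝ (⊤ : ℕ∞) b Ω ∧ ContDiffOn ℝ (⊤ : ℕ∞) c Ω ∧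
    (∀ y ∈ Ω, pd 1 a y = pd 0 b y) ∧ (∀ y ∈ Ω, pd 1 b y = pd 0 c y) ∧
    (∀ y ∈ Ω, 0 < a y) ∧ (∀ y ∈ Ω, 0 < a y * c y - b y * b y) ∧
    (∀ y ∈ Ω, hess f y = !![a y, b y; b y, c y]) := by
  have s0 := pd_smooth hΩ hsmooth 0
  have s1 := pd_smooth hΩ hsmooth 1
  have hH : ∀ y ∈ Ω, hess f y = !![pd 0 (pd 0 f) y, pd 0 (pd 1 f) y;
      pd 0 (pd 1 f) y, pd 1 (pd 1 f) y] := by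
    intro y hy
    have := pd_comm hΩ hsmooth 1 0 y hy
    ext i j
    fin_cases i <;> fin_cases j <;> simp [hess, this]
  refine ⟨pd 0 (pd 0 f), pd 0 (pd 1 f), pd 1 (pd 1 f), pd_smooth hΩ s0 0, pd_smooth hΩ s1 0,
    pd_smooth hΩ s1 1, ?_, ?_, ?_, ?_, hH⟩
  · intro y hy
    rw [pd_comm hΩ s0 1 0 y hy]
    exact pd_congr_s16 hΩ (pd_comm hΩ hsmooth 1 0) 0 y hy
  · intro y hy
    exact pd_comm hΩ s1 1 0 y hy
  · intro y hy
    have := (hconv y hy).diag_pos (i := 0)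
    rw [hH y hy] at this
    simpa using this
  · intro y hy
    have := (hconv y hy).det_pos
    rw [hH y hy, Matrix.det_fin_two] at this
    simpa using this

theorem inv_two (a b c : ℝ) :
    (!![a, b; b, c] : Matrix (Fin 2) (Fin 2) ℝ)⁻¹
      = !![(a*c-b*b)⁻¹*c, -((a*c-b*b)⁻¹*b); -((a*c-b*b)⁻¹*b), (a*c-b*b)⁻¹*a] := by
  rw [Matrix.inv_def, Matrix.adjugate_fin_two, Matrix.det_fin_two]
  ext i j
  fin_cases i <;> fin_cases j <;> simp

theorem gradSq_formula (f u : (Fin 2 → ℝ) → ℝ) (y : Fin 2 → ℝ) (a b c D : ℝ)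
    (hH : hess f y = !![a, b; b, c]) (hD : D = a*c-b*b) :
    gradSq f u y = D⁻¹ * (c * pd 0 u y * pd 0 u y - 2 * b * pd 0 u y * pd 1 u y
      + a * pd 1 u y * pd 1 u y) := by
  unfold gradSq
  rw [hH, inv_two, ← hD]
  simp [Fin.sum_univ_two]
  ring

theorem calabiLap_formula {Ω : Set (Fin 2 → ℝ)} (hΩ : IsOpen Ω) (f : (Fin 2 → ℝ) → ℝ)
    (a b c D h u u0 u1 u00 u01 u11 p q T1 T2 : (Fin 2 → ℝ) → ℝ)
    (hH : ∀ y ∈ Ω, hess f y = !![a y, b y; b y, c y])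
    (hD : ∀ y ∈ Ω, D y = a y * c y - b y * b y)
    (hh : ∀ y ∈ Ω, D y = Real.exp (-4 * h y))
    (a1 : HP Ω 1 a T1) (b0 : HP Ω 0 b T1) (b1 : HP Ω 1 b T2)
    (c0 : HP Ω 0 c T2) (h0 : HP Ω 0 h p) (h1 : HP Ω 1 h q)
    (hu0 : HP Ω 0 u u0) (hu1 : HP Ω 1 u u1)
    (hu00 : HP Ω 0 u0 u00) (hu01 : HP Ω 1 u0 u01) (hu10 : HP Ω 0 u1 u01) (hu11 : HP Ω 1 u1 u11) :
    ∀ x ∈ Ω, calabiLap f u x = (D x)⁻¹ * (c x * u00 x - 2 * b x * u01 x + a x * u11 x +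
      2 * (c x * p x * u0 x - b x * (p x * u1 x + q x * u0 x) + a x * q x * u1 x)) := by
  intro x hx
  have hdet : ∀ y ∈ Ω, (hess f y).det = Real.exp (-4 * h y) := by
    intro y hy
    rw [hH y hy, Matrix.det_fin_two, ← hh y hy, hD y hy]; simp
  have hsq : ∀ y ∈ Ω, Real.sqrt (hess f y).det = Real.exp (-2 * h y) := by
    intro y hy
    rw [hdet y hy, ← Real.exp_half]; congr 1; ring
  have hW : ∀ y ∈ Ω, ∀ i j, Real.sqrt (hess f y).det * (hess f y)⁻¹ i j
     = Real.exp (2 * h y) * (!![c y, - b y; - b y, a y] : Matrix (Fin 2) (Fin 2) ℝ) i j := by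
    intro y hy i j
    have e : Real.exp (2 * h y) = Real.exp (-2 * h y) * (Real.exp (-4 * h y))⁻¹ := by
      rw [← Real.exp_neg, ← Real.exp_add]; congr 1; ring
    rw [hsq y hy, hH y hy, inv_two, ← hD y hy, hh y hy, e]
    fin_cases i <;> fin_cases j <;> simp <;> ring
  have hE0 := (h0.cmul 2).exp
  have hE1 := (h1.cmul 2).exp
  have k00 : pd 0 (fun y => Real.sqrt (hess f y).det * (hess f y)⁻¹ 0 0 * pd 0 u y) x = _ :=
    (pd_congr_s16 hΩ (fun y hy => by rw [hW y hy, (hu0 y hy).2]; simp) 0 x hx).trans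
      (((hE0.mul c0).mul hu00) x hx).2
  have k01 : pd 0 (fun y => Real.sqrt (hess f y).det * (hess f y)⁻¹ 0 1 * pd 1 u y) x = _ :=
    (pd_congr_s16 hΩ (fun y hy => by rw [hW y hy, (hu1 y hy).2]; simp) 0 x hx).trans
      (((hE0.mul (b0.cmul (-1))).mul hu10) x hx).2
  have k10 : pd 1 (fun y => Real.sqrt (hess f y).det * (hess f y)⁻¹ 1 0 * pd 0 u y) x = _ :=
    (pd_congr_s16 hΩ (fun y hy => by rw [hW y hy, (hu0 y hy).2]; simp) 1 x hx).trans
      (((hE1.mul (b1.cmul (-1))).mul hu01) x hx).2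
  have k11 : pd 1 (fun y => Real.sqrt (hess f y).det * (hess f y)⁻¹ 1 1 * pd 1 u y) x = _ :=
    (pd_congr_s16 hΩ (fun y hy => by rw [hW y hy, (hu1 y hy).2]; simp) 1 x hx).trans
      (((hE1.mul a1).mul hu11) x hx).2
  unfold calabiLap
  rw [Fin.sum_univ_two, Fin.sum_univ_two, Fin.sum_univ_two, k00, k01, k10, k11, hsq x hx, hh x hx]
  have e1 : (Real.exp (-2 * h x))⁻¹ = Real.exp (2 * h x) := by
    rw [← Real.exp_neg]; congr 1; ring
  have e2 : (Real.exp (-4 * h x))⁻¹ = Real.exp (2 * h x) * Real.exp (2 * h x) := by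
    rw [← Real.exp_neg, ← Real.exp_add]; congr 1; ring
  rw [e1, e2]
  ring

theorem calabiLap_congr {Ω : Set (Fin 2 → ℝ)} (hΩ : IsOpen Ω) (f : (Fin 2 → ℝ) → ℝ)
    {u v : (Fin 2 → ℝ) → ℝ} (h : ∀ y ∈ Ω, u y = v y) :
    ∀ x ∈ Ω, calabiLap f u x = calabiLap f v x := by
  intro x hx
  unfold calabiLap
  congr 1
  refine Finset.sum_congr rfl fun i _ => Finset.sum_congr rfl fun j _ => ?_
  refine pd_congr_s16 hΩ (fun y hy => ?_) i x hx
  rw [pd_congr_s16 hΩ h j y hy]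

theorem gradSq_congr {Ω : Set (Fin 2 → ℝ)} (hΩ : IsOpen Ω) (f : (Fin 2 → ℝ) → ℝ)
    {u v : (Fin 2 → ℝ) → ℝ} (h : ∀ y ∈ Ω, u y = v y) :
    ∀ x ∈ Ω, gradSq f u x = gradSq f v x := by
  intro x hx
  unfold gradSq
  refine Finset.sum_congr rfl fun i _ => Finset.sum_congr rfl fun j _ => ?_
  rw [pd_congr_s16 hΩ h j x hx, pd_congr_s16 hΩ h i x hx]

/-- inequality (4.3): for a smooth strictly convex solution of PDE (1.2)
with `β = 0` (i.e. `Δρ = 0`) on a domain `Ω ⊆ ℝ²`, at every point where `Φ > 0` one has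
`ΔΦ ≥ ‖grad Φ‖²/Φ + Φ²`. -/
theorem statement16 (Ω : Set (Fin 2 → ℝ)) (hΩ : IsOpen Ω)
    (f : (Fin 2 → ℝ) → ℝ) (hsmooth : ContDiffOn ℝ (⊤ : ℕ∞) f Ω)
    (hconv : ∀ x ∈ Ω, (hess f x).PosDef) (hpde : PDE2 f 0 Ω) :
    ∀ x ∈ Ω, 0 < Phi f x →
      calabiLap f (Phi f) x ≥ gradSq f (Phi f) x / Phi f x + (Phi f x) ^ 2 := by
  obtain ⟨a, b, c, sa, sb, sc, hab, hbc, ha, hDpos, hH⟩ := hess_facts hΩ hsmooth hconv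
  obtain ⟨D, hDdef⟩ : ∃ D : (Fin 2 → ℝ) → ℝ, D = fun y => a y * c y - b y * b y := ⟨_, rfl⟩
  have hD : ∀ y ∈ Ω, D y = a y * c y - b y * b y := fun y _ => by rw [hDdef]
  have Dpos : ∀ y ∈ Ω, 0 < D y := fun y hy => by rw [hD y hy]; exact hDpos y hy
  have sD : ContDiffOn ℝ (⊤ : ℕ∞) D Ω := by rw [hDdef]; exact (sa.mul sc).sub (sb.mul sb)
  obtain ⟨h, hhdef⟩ : ∃ h : (Fin 2 → ℝ) → ℝ, h = fun y => (-1/4) * Real.log (D y) := ⟨_, rfl⟩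
  have sh : ContDiffOn ℝ (⊤ : ℕ∞) h Ω := by
    rw [hhdef]; exact contDiffOn_const.mul (sD.log fun y hy => (Dpos y hy).ne')
  have hh : ∀ y ∈ Ω, D y = Real.exp (-4 * h y) := by
    intro y hy
    have : -4 * h y = Real.log (D y) := by rw [hhdef]; ring
    rw [this, Real.exp_log (Dpos y hy)]
  -- jets of the Hessian entries
  have J : ∀ (g : (Fin 2 → ℝ) → ℝ), ContDiffOn ℝ (⊤ : ℕ∞) g Ω → ∀ i, HP Ω i g (pd i g) :=
    fun g sg i => HP.of_smooth hΩ sg fun _ _ => rfl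
  have S := fun (g : (Fin 2 → ℝ) → ℝ) (sg : ContDiffOn ℝ (⊤ : ℕ∞) g Ω) i => pd_smooth hΩ sg i
  have a0 := J a sa 0
  have a1 : HP Ω 1 a (pd 0 b) := HP.of_smooth hΩ sa hab
  have b0 := J b sb 0
  have b1 : HP Ω 1 b (pd 0 c) := HP.of_smooth hΩ sb hbc
  have c0 := J c sc 0
  have c1 := J c sc 1
  have T00 := J _ (S a sa 0) 0
  have T01 : HP Ω 1 (pd 0 a) (pd 0 (pd 0 b)) := HP.of_smooth hΩ (S a sa 0) fun y hy =>
    (pd_comm hΩ sa 1 0 y hy).trans (pd_congr_s16 hΩ hab 0 y hy)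
  have T10 := J _ (S b sb 0) 0
  have T11 : HP Ω 1 (pd 0 b) (pd 0 (pd 0 c)) := HP.of_smooth hΩ (S b sb 0) fun y hy =>
    (pd_comm hΩ sb 1 0 y hy).trans (pd_congr_s16 hΩ hbc 0 y hy)
  have T20 := J _ (S c sc 0) 0
  have T21 : HP Ω 1 (pd 0 c) (pd 0 (pd 1 c)) := HP.of_smooth hΩ (S c sc 0) fun y hy =>
    pd_comm hΩ sc 1 0 y hy
  have T30 := J _ (S c sc 1) 0
  have T31 := J _ (S c sc 1) 1
  -- second-order jets of a general function
  have J01 : ∀ (g : (Fin 2 → ℝ) → ℝ), ContDiffOn ℝ (⊤ : ℕ∞) g Ω →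
      HP Ω 0 (pd 1 g) (pd 1 (pd 0 g)) :=
    fun g sg => HP.of_smooth hΩ (S g sg 1) fun y hy => pd_comm hΩ sg 0 1 y hy
  have D0 := J D sD 0
  have D1 := J D sD 1
  have D00 := J _ (S D sD 0) 0
  have D01 := J _ (S D sD 0) 1
  have D11 := J _ (S D sD 1) 1
  have h0 := J h sh 0
  have h1 := J h sh 1
  have sp := S h sh 0
  have sq := S h sh 1
  have p0 := J _ sp 0
  have p1 := J _ sp 1
  have q0 := J01 h sh
  have q1 := J _ sq 1
  have sr := S _ sp 0
  have ss := S _ sp 1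
  have st := S _ sq 1
  have r0 := J _ sr 0
  have r1 := J _ sr 1
  have s0 : HP Ω 0 (pd 1 (pd 0 h)) (pd 1 (pd 0 (pd 0 h))) := J01 _ sp
  have s1 := J _ ss 1
  have t0 : HP Ω 0 (pd 1 (pd 1 h)) (pd 1 (pd 1 (pd 0 h))) :=
    HP.of_smooth hΩ st fun y hy =>
      (pd_comm hΩ sq 0 1 y hy).trans (pd_congr_s16 hΩ (pd_comm hΩ sh 0 1) 1 y hy)
  have t1 := J _ st 1
  generalize pd 1 (pd 1 (pd 1 h)) = u3 at *
  generalize pd 1 (pd 1 (pd 0 h)) = u2 at *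
  generalize pd 1 (pd 0 (pd 0 h)) = u1 at *
  generalize pd 0 (pd 0 (pd 0 h)) = u0 at *
  generalize pd 1 (pd 1 h) = t at *
  generalize pd 1 (pd 0 h) = s at *
  generalize pd 0 (pd 0 h) = r at *
  generalize pd 1 h = q at *
  generalize pd 0 h = p at *
  generalize pd 1 (pd 1 c) = Q4 at *
  generalize pd 0 (pd 1 c) = Q3 at *
  generalize pd 0 (pd 0 c) = Q2 at *
  generalize pd 0 (pd 0 b) = Q1 at *
  generalize pd 0 (pd 0 a) = Q0 at *
  generalize pd 1 c = T3 at *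
  generalize pd 0 c = T2 at *
  generalize pd 0 b = T1 at *
  generalize pd 0 a = T0 at *
  -- derivatives of the determinant
  have R0 : ∀ y ∈ Ω, pd 0 D y = -4 * (p y * D y) := by
    intro y hy
    have := HP.rel hΩ h0 ((D0.log fun y hy => (Dpos y hy).ne').cmul (-1/4))
      (fun y _ => by rw [hhdef]) y hy
    have hne := (Dpos y hy).ne'
    beta_reduce at this
    rw [this]; field_simp
  have R1 : ∀ y ∈ Ω, pd 1 D y = -4 * (q y * D y) := by
    intro y hy
    have := HP.rel hΩ h1 ((D1.log fun y hy => (Dpos y hy).ne').cmul (-1/4))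
      (fun y _ => by rw [hhdef]) y hy
    have hne := (Dpos y hy).ne'
    beta_reduce at this
    rw [this]; field_simp
  have R00 := HP.rel hΩ D00 ((p0.mul D0).cmul (-4)) R0
  have R01 := HP.rel hΩ D01 ((p1.mul D1).cmul (-4)) R0
  have R11 := HP.rel hΩ D11 ((q1.mul D1).cmul (-4)) R1
  have E0 := HP.rel hΩ D0 ((a0.mul c0).sub (b0.mul b0)) hD
  have E1 := HP.rel hΩ D1 ((a1.mul c1).sub (b1.mul b1)) hD
  have E00 := HP.rel hΩ D00 (((T00.mul c0).add (a0.mul T20)).sub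
    ((T10.mul b0).add (b0.mul T10))) (fun y hy => by rw [E0 y hy])
  have E01 := HP.rel hΩ D01 (((T01.mul c1).add (a1.mul T21)).sub
    ((T11.mul b1).add (b1.mul T11))) (fun y hy => by rw [E0 y hy])
  have E11 := HP.rel hΩ D11 (((T11.mul c1).add (a1.mul T31)).sub
    ((T21.mul b1).add (b1.mul T21))) (fun y hy => by rw [E1 y hy])
  -- rho
  have hrho : ∀ y ∈ Ω, rho f y = Real.exp (h y) := by
    intro y hy
    have hd : (hess f y).det = D y := by
      rw [hH y hy, Matrix.det_fin_two, hD y hy]; simp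
    unfold rho
    rw [hd, Real.rpow_def_of_pos (Dpos y hy), hhdef]
    congr 1
    push_cast
    ring
  -- the PDE
  have P : ∀ y ∈ Ω, c y * (r y + 3 * (p y * p y)) - 2 * (b y * (s y + 3 * (p y * q y)))
      + a y * (t y + 3 * (q y * q y)) = 0 := by
    intro y hy
    have e := hpde y hy
    rw [calabiLap_congr hΩ f hrho y hy,
      calabiLap_formula hΩ f a b c D h _ _ _ _ _ _ p q T1 T2 hH hD hh a1 b0 b1 c0 h0 h1
        h0.exp h1.exp (h0.exp.mul p0) (h1.exp.mul p1)
        (HP.of_smooth hΩ (sh.exp.mul sq) fun y hy => by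
          rw [((h0.exp.mul q0) y hy).2]; ring) (h1.exp.mul q1) y hy] at e
    have hne := (Dpos y hy).ne'
    have hex := (Real.exp_pos (h y)).ne'
    have e2 : (D y)⁻¹ * Real.exp (h y) * (c y * (r y + 3 * (p y * p y))
      - 2 * (b y * (s y + 3 * (p y * q y))) + a y * (t y + 3 * (q y * q y))) = 0 := by
      linear_combination e
    exact (mul_eq_zero.1 e2).resolve_left (mul_ne_zero (inv_ne_zero hne) hex)
  have P0 := HP.rel hΩ (((c0.mul (r0.add ((p0.mul p0).cmul 3))).sub
    ((b0.mul (s0.add ((p0.mul q0).cmul 3))).cmul 2)).add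
    (a0.mul (t0.add ((q0.mul q0).cmul 3)))) HP.zero P
  have P1 := HP.rel hΩ (((c1.mul (r1.add ((p1.mul p1).cmul 3))).sub
    ((b1.mul (s1.add ((p1.mul q1).cmul 3))).cmul 2)).add
    (a1.mul (t1.add ((q1.mul q1).cmul 3)))) HP.zero P
  -- Phi
  obtain ⟨F, hFdef⟩ : ∃ F : (Fin 2 → ℝ) → ℝ, F = fun y => Real.exp (4 * h y) *
    (c y * (p y * p y) - 2 * (b y * (p y * q y)) + a y * (q y * q y)) := ⟨_, rfl⟩
  have sF : ContDiffOn ℝ (⊤ : ℕ∞) F Ω := by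
    rw [hFdef]
    exact (contDiffOn_const.mul sh).exp.mul (((sc.mul (sp.mul sp)).sub
      (contDiffOn_const.mul (sb.mul (sp.mul sq)))).add (sa.mul (sq.mul sq)))
  have hEinv : ∀ y ∈ Ω, Real.exp (4 * h y) = (D y)⁻¹ := by
    intro y hy
    rw [hh y hy, ← Real.exp_neg]; congr 1; ring
  have hN : ∀ y ∈ Ω, F y * D y =
      c y * (p y * p y) - 2 * (b y * (p y * q y)) + a y * (q y * q y) := by
    intro y hy
    have hne := (Dpos y hy).ne'
    rw [hFdef]; beta_reduce; rw [hEinv y hy]; field_simp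
  have hPhi : ∀ y ∈ Ω, Phi f y = F y := by
    intro y hy
    unfold Phi
    rw [gradSq_congr hΩ f hrho y hy, gradSq_formula f _ y _ _ _ _ (hH y hy) (hD y hy),
      (h0.exp y hy).2, (h1.exp y hy).2, hrho y hy, hFdef]
    have hex := (Real.exp_pos (h y)).ne'
    beta_reduce
    rw [hEinv y hy]
    have hne := (Dpos y hy).ne'
    field_simp
  have F0 := J F sF 0
  have F1 := J F sF 1
  have F00 := J _ (S F sF 0) 0
  have F01 := J _ (S F sF 0) 1
  have F10 := J01 F sF
  have F11 := J _ (S F sF 1) 1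
  have N0 := HP.rel hΩ (F0.mul D0) (((c0.mul (p0.mul p0)).sub ((b0.mul (p0.mul q0)).cmul 2)).add
    (a0.mul (q0.mul q0))) hN
  have N1 := HP.rel hΩ (F1.mul D1) (((c1.mul (p1.mul p1)).sub ((b1.mul (p1.mul q1)).cmul 2)).add
    (a1.mul (q1.mul q1))) hN
  have N00 := HP.rel hΩ ((F00.mul D0).add (F0.mul D00))
    ((((T20.mul (p0.mul p0)).add (c0.mul ((r0.mul p0).add (p0.mul r0)))).sub
      (((T10.mul (p0.mul q0)).add (b0.mul ((r0.mul q0).add (p0.mul s0)))).cmul 2)).add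
      ((T00.mul (q0.mul q0)).add (a0.mul ((s0.mul q0).add (q0.mul s0))))) N0
  have N01 := HP.rel hΩ ((F01.mul D1).add (F1.mul D01))
    ((((T21.mul (p1.mul p1)).add (c1.mul ((r1.mul p1).add (p1.mul r1)))).sub
      (((T11.mul (p1.mul q1)).add (b1.mul ((r1.mul q1).add (p1.mul s1)))).cmul 2)).add
      ((T01.mul (q1.mul q1)).add (a1.mul ((s1.mul q1).add (q1.mul s1))))) N0
  have N11 := HP.rel hΩ ((F11.mul D1).add (F1.mul D11))
    ((((T31.mul (p1.mul p1)).add (c1.mul ((s1.mul p1).add (p1.mul s1)))).sub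
      (((T21.mul (p1.mul q1)).add (b1.mul ((s1.mul q1).add (p1.mul t1)))).cmul 2)).add
      ((T11.mul (q1.mul q1)).add (a1.mul ((t1.mul q1).add (q1.mul t1))))) N1
  intro x hx hpos
  rw [calabiLap_congr hΩ f hPhi x hx, gradSq_congr hΩ f hPhi x hx,
    calabiLap_formula hΩ f a b c D h F _ _ _ _ _ p q T1 T2 hH hD hh a1 b0 b1 c0 h0 h1
      F0 F1 F00 F01 F10 F11 x hx, gradSq_formula f _ x _ _ _ _ (hH x hx) (hD x hx), hPhi x hx]
  rw [hPhi x hx] at hpos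
  specialize hD x hx
  specialize R0 x hx
  specialize R1 x hx
  specialize R00 x hx
  specialize R01 x hx
  specialize R11 x hx
  specialize E0 x hx
  specialize E1 x hx
  specialize E00 x hx
  specialize E01 x hx
  specialize E11 x hx
  specialize P x hx
  specialize P0 x hx
  specialize P1 x hx
  specialize hN x hx
  specialize N0 x hx
  specialize N1 x hx
  specialize N00 x hx
  specialize N01 x hx
  specialize N11 x hx
  beta_reduce at *
  have hDx := Dpos x hx
  have hax := ha x hx
  have key := alg_core (a x) (b x) (c x) (D x) (T0 x) (T1 x) (T2 x) (T3 x) (Q0 x) (Q1 x) (Q2 x)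
    (Q3 x) (Q4 x) (p x) (q x) (r x) (s x) (t x) (u0 x) (u1 x) (u2 x) (u3 x) (F x) (pd 0 F x)
    (pd 1 F x) (pd 0 (pd 0 F) x) (pd 1 (pd 0 F) x) (pd 1 (pd 1 F) x) (pd 0 D x) (pd 1 D x)
    (pd 0 (pd 0 D) x) (pd 1 (pd 0 D) x) (pd 1 (pd 1 D) x) hax hDx hD
    (by linear_combination E0) (by linear_combination E1) R0 R1
    (by linear_combination E00) (by linear_combination E01) (by linear_combination E11)
    R00 R01 R11 (by linear_combination P) (by linear_combination P0) (by linear_combination P1)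
    (by linear_combination hN) (by linear_combination N0) (by linear_combination N1)
    (by linear_combination N00) (by linear_combination N01) (by linear_combination N11)
  generalize c x * pd 0 (pd 0 F) x - 2 * b x * pd 1 (pd 0 F) x + a x * pd 1 (pd 1 F) x +
    2 * (c x * p x * pd 0 F x - b x * (p x * pd 1 F x + q x * pd 0 F x)
      + a x * q x * pd 1 F x) = L at *
  generalize T0 x + 3 * a x * p x = X at *
  generalize T1 x + a x * q x + 2 * b x * p x = Y at *
  have hq : 0 ≤ c x * X ^ 2 - 2 * b x * X * Y + a x * Y ^ 2 := by
    have : a x * (c x * X ^ 2 - 2 * b x * X * Y + a x * Y ^ 2)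
        = (a x * Y - b x * X) ^ 2 + D x * X ^ 2 := by rw [hD]; ring
    have h2 : 0 ≤ a x * (c x * X ^ 2 - 2 * b x * X * Y + a x * Y ^ 2) := by
      rw [this]; positivity
    exact nonneg_of_mul_nonneg_right h2 hax
  have hk : 0 ≤ F x * L - (c x * pd 0 F x * pd 0 F x - 2 * b x * pd 0 F x * pd 1 F x
      + a x * pd 1 F x * pd 1 F x) - F x ^ 3 * D x := by
    have hp : 0 < D x * a x ^ 2 := by positivity
    refine nonneg_of_mul_nonneg_right ?_ hp
    rw [key]
    positivity
  generalize c x * pd 0 F x * pd 0 F x - 2 * b x * pd 0 F x * pd 1 F x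
      + a x * pd 1 F x * pd 1 F x = G at *
  have : (D x)⁻¹ * L - ((D x)⁻¹ * G / F x + F x ^ 2)
      = (F x * L - G - F x ^ 3 * D x) / (D x * F x) := by
    field_simp
    ring
  have h3 : 0 ≤ (F x * L - G - F x ^ 3 * D x) / (D x * F x) := by positivity
  linarith
end
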